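/- Bethe eigenstate theorem: Under the hypotheses of the algebraic Bethe ansatz expansion formulas (operators A, B, D on a complex vector space V satisfying the exchange relations with f(μ,λ) = 1 + i/(μ−λ), g(μ,λ) = i/(μ−λ), pairwise distinct μ, λ₁,…,λ_M ∈ ℂ, and a vector Ω with A(ν)Ω = a(ν)Ω, D(ν)Ω = d(ν)Ω), assume additionally that the Bethe equations hold: for each n = 1,…,M, a(λ_n)·g(λ_n,μ)·∏_{j≠n} f(λ_n,λ_j) + d(λ_n)·g(μ,λ_n)·∏_{j≠n} f(λ_j,λ_n) = 0. Then the vector Ψ = B(λ₁)⋯B(λ_M)Ω satisfies (A(μ)+D(μ))Ψ = (a(μ)·∏_{i=1}^M f(μ,λ_i) + d(μ)·∏_{i=1}^M f(λ_i,μ))·Ψ, i.e. Ψ is an eigenvector of the transfer matrix T(μ) = A(μ)+D(μ). -/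

import Mathlib

/-- The XXX Bethe-ansatz function `f(μ,λ) = 1 + i/(μ−λ)`. -/
noncomputable def betheF (mu lam : ℂ) : ℂ := 1 + Complex.I / (mu - lam)

/-- The XXX Bethe-ansatz function `g(μ,λ) = i/(μ−λ)`. -/
noncomputable def betheG (mu lam : ℂ) : ℂ := Complex.I / (mu - lam)

/-- Moving `A x` through a string of operators `B y` by means of a two-term exchange relation
whose coefficients satisfy `f x y * g x z - g x y * g y z = g x z * f z y`. -/
theorem exchange_expansion {R V α : Type*} [CommRing R] [AddCommGroup V] [Module R V]
    [DecidableEq α] {S : Set α} {A B : α → Module.End R V} {f g : α → α → R} {a : α → R} {Ω : V}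
    (hBB : ∀ x ∈ S, ∀ y ∈ S, x ≠ y → B x * B y = B y * B x)
    (hAB : ∀ x ∈ S, ∀ y ∈ S, x ≠ y →
      A x * B y = f x y • (B y * A x) - g x y • (B x * A y))
    (hA : ∀ x ∈ S, A x Ω = a x • Ω)
    (hfg : ∀ x y z, x ≠ y → y ≠ z → x ≠ z → f x y * g x z - g x y * g y z = g x z * f z y)
    (l : List α) (hl : l.Nodup) (hlS : ∀ y ∈ l, y ∈ S) (x : α) (hx : x ∈ S) (hxl : x ∉ l) :
    A x ((l.map B).prod Ω) = (a x * (l.map (f x)).prod) • (l.map B).prod Ω -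
      ∑ n ∈ l.toFinset, (a n * g x n * ((l.erase n).map (f n)).prod) •
        B x (((l.erase n).map B).prod Ω) := by
  induction l generalizing x with
  | nil => simp [hA x hx]
  | cons y t ih =>
    obtain ⟨hyt, ht⟩ := List.nodup_cons.1 hl
    obtain ⟨hxy, hxt⟩ := not_or.1 (List.mem_cons.not.1 hxl)
    have hy : y ∈ S := hlS y List.mem_cons_self
    have htS : ∀ z ∈ t, z ∈ S := fun z hz => hlS z (List.mem_cons_of_mem y hz)
    have hterm : ∀ n ∈ t.toFinset,
        (a n * g x n * (((y :: t).erase n).map (f n)).prod) •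
            B x ((((y :: t).erase n).map B).prod Ω) =
          f x y • B y ((a n * g x n * ((t.erase n).map (f n)).prod) •
            B x (((t.erase n).map B).prod Ω)) -
          g x y • B x ((a n * g y n * ((t.erase n).map (f n)).prod) •
            B y (((t.erase n).map B).prod Ω)) := by
      intro n hn
      have hn : n ∈ t := List.mem_toFinset.1 hn
      have hyn : y ≠ n := fun h => hyt (h ▸ hn)
      have hxn : x ≠ n := fun h => hxt (h ▸ hn)
      have hB := fun v => LinearMap.congr_fun (hBB x hx y hy hxy) v
      simp only [Module.End.mul_apply] at hB
      rw [List.erase_cons_tail (by simpa using hyn)]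
      simp only [List.map_cons, List.prod_cons, Module.End.mul_apply, map_smul, ← hB, smul_smul,
        ← sub_smul]
      congr 1
      linear_combination (-(a n * ((t.erase n).map (f n)).prod)) * hfg x y n hxy hyn hxn
    have hAB' := LinearMap.congr_fun (hAB x hx y hy hxy) ((t.map B).prod Ω)
    simp only [Module.End.mul_apply, LinearMap.sub_apply, LinearMap.smul_apply] at hAB'
    rw [List.toFinset_cons, Finset.sum_insert (by simpa using hyt), Finset.sum_congr rfl hterm,
      Finset.sum_sub_distrib, ← Finset.smul_sum, ← Finset.smul_sum, ← map_sum, ← map_sum,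
      List.erase_cons_head]
    simp only [List.map_cons, List.prod_cons, Module.End.mul_apply]
    rw [hAB', ih ht htS x hx hxt, ih ht htS y hy hyt]
    simp only [map_sub, map_smul]
    module

theorem betheG_swap (x y : ℂ) : betheG y x = -betheG x y := by
  rw [betheG, betheG, ← neg_sub x y, div_neg]

theorem betheF_mul_betheG_sub {x y z : ℂ} (hxy : x ≠ y) (hyz : y ≠ z) (hxz : x ≠ z) :
    betheF x y * betheG x z - betheG x y * betheG y z = betheG x z * betheF z y := by
  have h₁ := sub_ne_zero.2 hxy
  have h₂ := sub_ne_zero.2 hyz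
  have h₃ := sub_ne_zero.2 hxz
  have h₄ := sub_ne_zero.2 hyz.symm
  rw [betheF, betheF, betheG, betheG, betheG]
  field_simp
  ring

theorem betheF_mul_betheG_sub_swap {x y z : ℂ} (hxy : x ≠ y) (hyz : y ≠ z) (hxz : x ≠ z) :
    betheF y x * betheG z x - betheG y x * betheG z y = betheG z x * betheF y z := by
  have h₁ := sub_ne_zero.2 hxy.symm
  have h₂ := sub_ne_zero.2 hyz
  have h₃ := sub_ne_zero.2 hxz.symm
  have h₄ := sub_ne_zero.2 hyz.symm
  rw [betheF, betheF, betheG, betheG, betheG]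
  field_simp
  ring

theorem prod_map_erase_ofFn {α R : Type*} [DecidableEq α] [CommMonoid R] {M : ℕ} {u : Fin M → α}
    (hu : Function.Injective u) (h : α → R) (n : Fin M) :
    (((List.ofFn u).erase (u n)).map h).prod = ∏ j ∈ Finset.univ.erase n, h (u j) := by
  rw [List.ofFn_eq_map, ← List.map_erase hu, List.map_map,
    ← List.prod_toFinset _ ((List.nodup_finRange M).erase n)]
  refine Finset.prod_congr ?_ fun _ _ => rfl
  ext j
  simp [(List.nodup_finRange M).mem_erase_iff]

/-- **Bethe eigenstate theorem.** Under the algebraic Bethe ansatz exchange relations and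
vacuum eigenvalue relations, if the Bethe equations
`a(λ_n)·g(λ_n,μ)·∏_{j≠n} f(λ_n,λ_j) + d(λ_n)·g(μ,λ_n)·∏_{j≠n} f(λ_j,λ_n) = 0`
hold, then `Ψ = B(λ₁)⋯B(λ_M)Ω` is an eigenvector of the transfer matrix
`T(μ) = A(μ) + D(μ)` with eigenvalue `a(μ)·∏ f(μ,λᵢ) + d(μ)·∏ f(λᵢ,μ)`. -/
theorem bethe_eigenstate
    (V : Type*) [AddCommGroup V] [Module ℂ V]
    (M : ℕ) (mu : ℂ) (lam : Fin M → ℂ)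
    (hdist : Function.Injective lam) (hne : ∀ n, lam n ≠ mu)
    (A B D : ℂ → Module.End ℂ V) (a d : ℂ → ℂ) (Ω : V)
    (hBB : ∀ ν ∈ insert mu (Set.range lam), ∀ ν' ∈ insert mu (Set.range lam), ν ≠ ν' →
      B ν * B ν' = B ν' * B ν)
    (hAB : ∀ ν ∈ insert mu (Set.range lam), ∀ ν' ∈ insert mu (Set.range lam), ν ≠ ν' →
      A ν * B ν' = betheF ν ν' • (B ν' * A ν) - betheG ν ν' • (B ν * A ν'))
    (hDB : ∀ ν ∈ insert mu (Set.range lam), ∀ ν' ∈ insert mu (Set.range lam), ν ≠ ν' →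
      D ν * B ν' = betheF ν' ν • (B ν' * D ν) - betheG ν' ν • (B ν * D ν'))
    (hA : ∀ ν ∈ insert mu (Set.range lam), A ν Ω = a ν • Ω)
    (hD : ∀ ν ∈ insert mu (Set.range lam), D ν Ω = d ν • Ω)
    (hbethe : ∀ n : Fin M,
      a (lam n) * betheG (lam n) mu * ∏ j ∈ Finset.univ.erase n, betheF (lam n) (lam j) +
      d (lam n) * betheG mu (lam n) * ∏ j ∈ Finset.univ.erase n, betheF (lam j) (lam n)
        = 0) :
    (A mu + D mu) ((List.ofFn fun n => B (lam n)).prod Ω) =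
      (a mu * ∏ i : Fin M, betheF mu (lam i) + d mu * ∏ i : Fin M, betheF (lam i) mu) •
        ((List.ofFn fun n => B (lam n)).prod Ω) := by
  classical
  have hl : (List.ofFn lam).Nodup := List.nodup_ofFn.2 hdist
  have hlS : ∀ y ∈ List.ofFn lam, y ∈ insert mu (Set.range lam) := fun y hy =>
    Set.mem_insert_of_mem _ (List.mem_ofFn.1 hy)
  have hmu : mu ∉ List.ofFn lam := by simpa [List.mem_ofFn] using hne
  have hexpA := exchange_expansion hBB hAB hA (fun _ _ _ => betheF_mul_betheG_sub)
    _ hl hlS mu (Set.mem_insert _ _) hmu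
  have hexpD := exchange_expansion (f := fun x y => betheF y x) (g := fun x y => betheG y x)
    hBB hDB hD (fun _ _ _ => betheF_mul_betheG_sub_swap) _ hl hlS mu (Set.mem_insert _ _) hmu
  have hcancel : ∑ n ∈ (List.ofFn lam).toFinset,
        (a n * betheG mu n * (((List.ofFn lam).erase n).map (betheF n)).prod) •
          B mu ((((List.ofFn lam).erase n).map B).prod Ω) +
      ∑ n ∈ (List.ofFn lam).toFinset,
        (d n * betheG n mu * (((List.ofFn lam).erase n).map fun y => betheF y n).prod) •
          B mu ((((List.ofFn lam).erase n).map B).prod Ω) = 0 := by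
    rw [← Finset.sum_add_distrib]
    refine Finset.sum_eq_zero fun x hx => ?_
    obtain ⟨n, rfl⟩ := List.mem_ofFn.1 (List.mem_toFinset.1 hx)
    rw [← add_smul, prod_map_erase_ofFn hdist, prod_map_erase_ofFn hdist]
    convert zero_smul ℂ _
    have h := hbethe n
    rw [betheG_swap mu (lam n)] at h ⊢
    linear_combination -h
  have hmap : (List.ofFn fun n => B (lam n)) = (List.ofFn lam).map B := by
    rw [List.map_ofFn]; rfl
  rw [hmap, LinearMap.add_apply, hexpA, hexpD, sub_add_sub_comm, hcancel, sub_zero, ← add_smul]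
  simp [List.map_ofFn, List.prod_ofFn]
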